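/- Let p₀, p₁, p₂ be positive integers, let n = p₀ + p₁ + p₂, and let σ₀, σ₁ be the monodromy permutations of the dessin D(p₀, p₁, p₂). For integers k₁, k₂, the permutation (σ₀σ₁)^{k₁}(σ₁σ₀)^{k₂} equals the identity if and only if k₁p₁ + k₂p₂ ≡ 0 (mod n), k₁p₂ + k₂p₀ ≡ 0 (mod n), and k₁p₀ + k₂p₁ ≡ 0 (mod n). -/

import Mathlib

/-- Rotation about the black vertex: `(m, i) ↦ (m, i+1)` on `ZMod n × Fin 3`. -/
def sigma0 (n : ℕ) : Equiv.Perm (ZMod n × Fin 3) :=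
  (Equiv.refl (ZMod n)).prodCongr (Equiv.addRight (1 : Fin 3))

/-- The amount subtracted from the first coordinate by `σ₁`, by side index. -/
def shift (p0 p1 p2 n : ℕ) : Fin 3 → ZMod n := ![(p1 : ZMod n), (p2 : ZMod n), (p0 : ZMod n)]

/-- Rotation about the white vertex:
`(m,0) ↦ (m-p₁,2)`, `(m,1) ↦ (m-p₂,0)`, `(m,2) ↦ (m-p₀,1)`. -/
def sigma1 (p0 p1 p2 n : ℕ) : Equiv.Perm (ZMod n × Fin 3) where
  toFun x := (x.1 - shift p0 p1 p2 n x.2, x.2 + 2)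
  invFun x := (x.1 + shift p0 p1 p2 n (x.2 + 1), x.2 + 1)
  left_inv := by
    rintro ⟨m, i⟩
    fin_cases i <;> simp [shift]
  right_inv := by
    rintro ⟨m, i⟩
    fin_cases i <;> simp [shift]

/-- The permutation translating the fibre over `i` by `-a i`. -/
def fibreTranslation {n : ℕ} (a : Fin 3 → ZMod n) : Equiv.Perm (ZMod n × Fin 3) where
  toFun x := (x.1 - a x.2, x.2)
  invFun x := (x.1 + a x.2, x.2)
  left_inv x := by simp
  right_inv x := by simp

theorem fibreTranslation_mul {n : ℕ} (a b : Fin 3 → ZMod n) :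
    fibreTranslation a * fibreTranslation b = fibreTranslation (a + b) := by
  ext x <;> simp [fibreTranslation, sub_sub, add_comm]

/-- `fibreTranslation` as a homomorphism. -/
def fibreTranslationHom (n : ℕ) :
    Multiplicative (Fin 3 → ZMod n) →* Equiv.Perm (ZMod n × Fin 3) :=
  MonoidHom.mk' (fun a => fibreTranslation a.toAdd)
    fun a b => (fibreTranslation_mul a.toAdd b.toAdd).symm

theorem fibreTranslation_zpow {n : ℕ} (a : Fin 3 → ZMod n) (k : ℤ) :
    fibreTranslation a ^ k = fibreTranslation (k • a) :=
  (map_zpow (fibreTranslationHom n) (Multiplicative.ofAdd a) k).symm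

theorem fibreTranslation_eq_one_iff {n : ℕ} (a : Fin 3 → ZMod n) :
    fibreTranslation a = 1 ↔ ∀ i, a i = 0 := by
  constructor
  · intro h i
    simpa [fibreTranslation] using congrArg Prod.fst (Equiv.congr_fun h (0, i))
  · intro h
    ext x <;> simp [fibreTranslation, h]

theorem sigma0_mul_sigma1 (p0 p1 p2 n : ℕ) :
    sigma0 n * sigma1 p0 p1 p2 n = fibreTranslation (shift p0 p1 p2 n) := by
  ext ⟨m, i⟩ <;> fin_cases i <;> simp [sigma0, sigma1, fibreTranslation]

theorem sigma1_mul_sigma0 (p0 p1 p2 n : ℕ) :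
    sigma1 p0 p1 p2 n * sigma0 n = fibreTranslation fun i => shift p0 p1 p2 n (i + 1) := by
  ext ⟨m, i⟩ <;> fin_cases i <;> simp [sigma0, sigma1, fibreTranslation]

theorem stmt_11 (p0 p1 p2 : ℕ) (hp0 : 0 < p0) (hp1 : 0 < p1) (hp2 : 0 < p2)
    (n : ℕ) (hn : n = p0 + p1 + p2)
    (σ0 σ1 : Equiv.Perm (ZMod n × Fin 3))
    (hσ0 : σ0 = sigma0 n) (hσ1 : σ1 = sigma1 p0 p1 p2 n) :
    ∀ k1 k2 : ℤ,
      (σ0 * σ1) ^ k1 * (σ1 * σ0) ^ k2 = 1 ↔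
        (k1 * p1 + k2 * p2 ≡ 0 [ZMOD (n : ℤ)] ∧
         k1 * p2 + k2 * p0 ≡ 0 [ZMOD (n : ℤ)] ∧
         k1 * p0 + k2 * p1 ≡ 0 [ZMOD (n : ℤ)]) := by
  intro k1 k2
  rw [hσ0, hσ1, sigma0_mul_sigma1, sigma1_mul_sigma0, fibreTranslation_zpow,
    fibreTranslation_zpow, fibreTranslation_mul, fibreTranslation_eq_one_iff, Fin.forall_fin_succ,
    Fin.forall_fin_two]
  simp [← ZMod.intCast_eq_intCast_iff, shift]
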